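/- Let 0 < p₀ ≤ p < ∞, 0 < q₀ ≤ q < ∞ with q/p ≤ q₀/p₀, and let f, g be measurable functions on (0,∞) satisfying condition (D). Assume that ∫₀^∞ (f*(t)^{q₀} − g*(t)^{q₀}) d(t^{q₀/p₀}) ≥ 0 and that the function t ↦ (f*(t)^{q} − g*(t)^{q}) t^{q/p−1} belongs to L¹(0,∞). Then ∫₀^∞ (f*(t)^{q} − g*(t)^{q}) d(t^{q/p}) ≥ 0; consequently, if f, g ∈ L(p,q), then ‖g‖_{L(p,q)} ≤ ‖f‖_{L(p,q)}. -/

import Mathlib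

open MeasureTheory Set Real Filter
open scoped ENNReal NNReal

/-- The distribution function `λ_f(τ) = |{t > 0 : |f t| > τ}|` of a function on `(0,∞)`
with respect to Lebesgue measure. -/
noncomputable def distribFn (f : ℝ → ℝ) (τ : ℝ) : ℝ≥0∞ :=
  (volume.restrict (Set.Ioi (0:ℝ))) {t : ℝ | τ < |f t|}

/-- The non-increasing rearrangement `f*(s) = inf{τ > 0 : λ_f(τ) ≤ s}`. -/
noncomputable def rearr (f : ℝ → ℝ) (s : ℝ) : ℝ :=
  sInf {τ : ℝ | 0 < τ ∧ distribFn f τ ≤ ENNReal.ofReal s}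

/-- Condition (D): there is `τ₀ ∈ (0,∞)` such that `λ_f(τ) ≤ λ_g(τ)` for `τ < τ₀` and
`λ_f(τ) ≥ λ_g(τ)` for `τ > τ₀`. -/
def CondD (f g : ℝ → ℝ) : Prop :=
  ∃ τ₀ : ℝ, 0 < τ₀ ∧ (∀ τ : ℝ, 0 < τ → τ < τ₀ → distribFn f τ ≤ distribFn g τ) ∧
    (∀ τ : ℝ, τ₀ < τ → distribFn g τ ≤ distribFn f τ)

theorem rearr_nonneg (f : ℝ → ℝ) (s : ℝ) : 0 ≤ rearr f s :=
  Real.sInf_nonneg fun _ h => h.1.le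

theorem distribFn_antitone (f : ℝ → ℝ) : Antitone (distribFn f) := fun _ _ h =>
  measure_mono fun _ ht => lt_of_le_of_lt h ht

theorem bddBelow_rearr_set (f : ℝ → ℝ) (s : ℝ) :
    BddBelow {τ : ℝ | 0 < τ ∧ distribFn f τ ≤ ENNReal.ofReal s} :=
  ⟨0, fun _ h => h.1.le⟩

/-- A distribution function that is finite somewhere tends to zero at infinity. -/
theorem rearr_set_nonempty {f : ℝ → ℝ} (hf : Measurable f) {τ₁ : ℝ}
    (hτ : distribFn f τ₁ ≠ ∞) {s : ℝ} (hs : 0 < s) :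
    {τ : ℝ | 0 < τ ∧ distribFn f τ ≤ ENNReal.ofReal s}.Nonempty := by
  have hlim : Tendsto (fun n : ℕ => distribFn f n) atTop (nhds 0) := by
    have hempty : ⋂ n : ℕ, {t : ℝ | (n : ℝ) < |f t|} = ∅ := by
      ext t
      simp only [mem_iInter, mem_ofPred_eq, mem_empty_iff_false, iff_false, not_forall, not_lt]
      exact exists_nat_ge _
    have h := tendsto_measure_iInter_atTop (μ := volume.restrict (Set.Ioi (0 : ℝ)))
      (s := fun n : ℕ => {t : ℝ | (n : ℝ) < |f t|})
      (fun n => (measurableSet_lt measurable_const hf.abs).nullMeasurableSet)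
      (fun m n hmn t (ht : (n : ℝ) < |f t|) => show (m : ℝ) < |f t| from
        lt_of_le_of_lt (Nat.cast_le.mpr hmn) ht) ?_
    · rw [hempty, measure_empty] at h
      exact h
    · obtain ⟨n, hn⟩ := exists_nat_ge τ₁
      exact ⟨n, ne_top_of_le_ne_top hτ (distribFn_antitone f hn)⟩
  have hev := hlim.eventually (ge_mem_nhds (ENNReal.ofReal_pos.mpr hs))
  obtain ⟨n, hn, hn'⟩ := (hev.and (eventually_gt_atTop 0)).exists
  exact ⟨n, Nat.cast_pos.mpr hn', hn⟩

theorem rearr_eq_zero_of_distribFn_eq_top {f : ℝ → ℝ} (hf : ∀ τ, distribFn f τ = ∞) (s : ℝ) :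
    rearr f s = 0 := by
  simp [rearr, hf]

theorem rearr_antitoneOn {f : ℝ → ℝ} (hf : Measurable f) {τ₁ : ℝ} (hτ : distribFn f τ₁ ≠ ∞) :
    AntitoneOn (rearr f) (Set.Ioi 0) := fun _ hs _ _ hst =>
  csInf_le_csInf (bddBelow_rearr_set f _) (rearr_set_nonempty hf hτ hs) fun _ h =>
    ⟨h.1, h.2.trans (ENNReal.ofReal_le_ofReal hst)⟩

/-- A single crossing of the distribution functions at height `τ₀` separates the values of the
rearrangements. -/
theorem rearr_crossing {f g : ℝ → ℝ} (hf : Measurable f) (hg : Measurable g) {τ₀ τf τg : ℝ}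
    (hlow : ∀ τ : ℝ, 0 < τ → τ < τ₀ → distribFn f τ ≤ distribFn g τ)
    (hhigh : ∀ τ : ℝ, τ₀ < τ → distribFn g τ ≤ distribFn f τ)
    (hτf : distribFn f τf ≠ ∞) (hτg : distribFn g τg ≠ ∞) {s : ℝ} (hs : 0 < s) :
    (τ₀ ≤ rearr g s ∧ rearr g s ≤ rearr f s) ∨ (rearr f s ≤ rearr g s ∧ rearr g s ≤ τ₀) := by
  rcases lt_trichotomy (rearr g s) τ₀ with h | h | h
  · refine Or.inr ⟨le_of_forall_gt_imp_ge_of_dense fun a ha => ?_, h.le⟩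
    obtain ⟨τ, hτ, hτa⟩ := exists_lt_of_csInf_lt (rearr_set_nonempty hg hτg hs)
      (lt_min h ha : sInf _ < min τ₀ a)
    exact (csInf_le (bddBelow_rearr_set f s)
      ⟨hτ.1, (hlow τ hτ.1 (hτa.trans_le (min_le_left _ _))).trans hτ.2⟩).trans
      (hτa.le.trans (min_le_right _ _))
  · rcases le_total (rearr f s) (rearr g s) with h' | h'
    · exact Or.inr ⟨h', h.le⟩
    · exact Or.inl ⟨h.ge, h'⟩
  · refine Or.inl ⟨h.le, le_csInf (rearr_set_nonempty hf hτf hs) fun τ hτ => ?_⟩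
    by_contra! hlt
    obtain ⟨τ', h1, h2⟩ := exists_between (max_lt hlt h)
    have hpos : 0 < τ' := hτ.1.trans ((le_max_left _ _).trans_lt h1)
    refine absurd h2 (not_lt.mpr (csInf_le (bddBelow_rearr_set g s) ⟨hpos, ?_⟩))
    exact (hhigh τ' ((le_max_right _ _).trans_lt h1)).trans
      ((distribFn_antitone f ((le_max_left _ _).trans h1.le)).trans hτ.2)

/-- The dichotomy for the rearrangements under condition (D): one dominates the other, or they
cross at a point `t₀` at height `τ₀`. -/
theorem CondD.rearr_dichotomy {f g : ℝ → ℝ} (hf : Measurable f) (hg : Measurable g)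
    (hD : CondD f g) :
    (∀ t > 0, rearr f t ≤ rearr g t) ∨ (∀ t > 0, rearr g t ≤ rearr f t) ∨
    ∃ τ₀ > 0, ∃ t₀ > 0, ∀ t > 0,
      (t ≤ t₀ ∧ τ₀ ≤ rearr g t ∧ rearr g t ≤ rearr f t) ∨
      (t₀ ≤ t ∧ rearr f t ≤ rearr g t ∧ rearr g t ≤ τ₀) := by
  obtain ⟨τ₀, hτ₀, hlow, hhigh⟩ := hD
  by_cases hftop : ∀ τ, distribFn f τ = ∞
  · exact Or.inl fun t _ =>
      (rearr_eq_zero_of_distribFn_eq_top hftop t).trans_le (rearr_nonneg g t)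
  by_cases hgtop : ∀ τ, distribFn g τ = ∞
  · exact Or.inr <| Or.inl fun t _ =>
      (rearr_eq_zero_of_distribFn_eq_top hgtop t).trans_le (rearr_nonneg f t)
  push Not at hftop hgtop
  obtain ⟨τf, hτf⟩ := hftop
  obtain ⟨τg, hτg⟩ := hgtop
  have hcross : ∀ t > 0, (τ₀ < rearr f t ∧ τ₀ ≤ rearr g t ∧ rearr g t ≤ rearr f t) ∨
      (rearr f t ≤ τ₀ ∧ rearr f t ≤ rearr g t ∧ rearr g t ≤ τ₀) := fun t ht => by
    rcases rearr_crossing hf hg hlow hhigh hτf hτg ht with h | h <;>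
      rcases lt_or_ge τ₀ (rearr f t) with h' | h' <;> grind
  have hanti := rearr_antitoneOn hf hτf
  set A : Set ℝ := {t | 0 < t ∧ τ₀ < rearr f t}
  have hbound : ∀ t > 0, rearr f t ≤ τ₀ → t ∈ upperBounds A := fun t ht h u hu => by
    by_contra! hlt
    exact absurd (hanti ht hu.1 hlt.le) (not_le.mpr (h.trans_lt hu.2))
  rcases A.eq_empty_or_nonempty with hne | hne
  · refine Or.inl fun t ht => ?_
    rcases hcross t ht with h | h
    · exact absurd (show t ∈ A from ⟨ht, h.1⟩) (hne ▸ notMem_empty t)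
    · exact h.2.1
  refine Or.inr ?_
  by_cases hbdd : BddAbove A
  · obtain ⟨u, hu⟩ := hne
    refine Or.inr ⟨τ₀, hτ₀, sSup A, hu.1.trans_le (le_csSup hbdd hu), fun t ht => ?_⟩
    rcases hcross t ht with h | h
    · exact Or.inl ⟨le_csSup hbdd ⟨ht, h.1⟩, h.2⟩
    · exact Or.inr ⟨csSup_le ⟨u, hu⟩ (hbound t ht h.1), h.2⟩
  · refine Or.inl fun t ht => ?_
    rcases hcross t ht with h | h
    · exact h.2.2
    · exact absurd ⟨t, hbound t ht h.1⟩ hbdd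

/-- The tangent line inequality for the convex function `u ↦ u ^ r`. -/
theorem rpow_tangent_le {u v r : ℝ} (hu : 0 ≤ u) (hv : 0 < v) (hr : 1 ≤ r) :
    r * v ^ (r - 1) * (u - v) ≤ u ^ r - v ^ r := by
  have h := one_add_mul_self_le_rpow_one_add (s := u / v - 1)
    (by linarith [div_nonneg hu hv.le]) hr
  rw [add_sub_cancel, div_rpow hu hv.le, le_div_iff₀ (rpow_pos_of_pos hv r)] at h
  have hvr : v ^ r = v ^ (r - 1) * v := by
    rw [← rpow_add_one hv.ne', sub_add_cancel]
  have he : (1 + r * (u / v - 1)) * v ^ r = v ^ r + r * v ^ (r - 1) * (u - v) := by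
    rw [hvr]
    field_simp
  linarith

/-- Comparison of differences of powers on either side of a threshold `τ`. -/
theorem rpow_sub_rpow_compare {x y τ q₀ q : ℝ} (hx : 0 ≤ x) (hy : 0 ≤ y) (hτ : 0 < τ)
    (hq₀ : 0 < q₀) (hqq : q₀ ≤ q) (h : (τ ≤ y ∧ y ≤ x) ∨ (x ≤ y ∧ y ≤ τ)) :
    q / q₀ * (τ ^ q₀) ^ (q / q₀ - 1) * (x ^ q₀ - y ^ q₀) ≤ x ^ q - y ^ q := by
  rcases hy.eq_or_lt with rfl | hy
  · have : x = 0 := by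
      rcases h with h | h <;> linarith
    simp [this]
  have hr : 1 ≤ q / q₀ := (one_le_div hq₀).mpr hqq
  have hr0 : 0 ≤ q / q₀ := by linarith
  have hmul : q₀ * (q / q₀) = q := mul_div_cancel₀ q hq₀.ne'
  have htan := rpow_tangent_le (rpow_nonneg hx q₀) (rpow_pos_of_pos hy q₀) hr
  rw [← rpow_mul hx q₀ (q / q₀), ← rpow_mul hy.le q₀ (q / q₀), hmul] at htan
  refine le_trans ?_ htan
  rcases h with ⟨h1, h2⟩ | ⟨h1, h2⟩
  · refine mul_le_mul_of_nonneg_right (mul_le_mul_of_nonneg_left ?_ hr0)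
      (sub_nonneg.mpr (rpow_le_rpow hy.le h2 hq₀.le))
    exact rpow_le_rpow (rpow_nonneg hτ.le _) (rpow_le_rpow hτ.le h1 hq₀.le) (by linarith)
  · refine mul_le_mul_of_nonpos_right (mul_le_mul_of_nonneg_left ?_ hr0)
      (sub_nonpos.mpr (rpow_le_rpow hx h1 hq₀.le))
    exact rpow_le_rpow (rpow_nonneg hy.le _) (rpow_le_rpow hy.le h2 hq₀.le) (by linarith)

/-- Comparison of power weights for a function changing sign from nonnegative to nonpositive
at `t₀`. -/
theorem mul_rpow_compare {d t t₀ a₀ a : ℝ} (ht : 0 < t) (ht₀ : 0 < t₀) (ha : a ≤ a₀)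
    (h : (t ≤ t₀ ∧ 0 ≤ d) ∨ (t₀ ≤ t ∧ d ≤ 0)) :
    t₀ ^ (a - a₀) * (d * t ^ (a₀ - 1)) ≤ d * t ^ (a - 1) := by
  have he : t ^ (a - 1) = t ^ (a - a₀) * t ^ (a₀ - 1) := by
    rw [← rpow_add ht]
    ring_nf
  have hpos := (rpow_pos_of_pos ht (a₀ - 1)).le
  rw [he, mul_left_comm, ← mul_assoc, ← mul_assoc]
  refine mul_le_mul_of_nonneg_right ?_ hpos
  rcases h with ⟨h1, h2⟩ | ⟨h1, h2⟩
  · exact mul_le_mul_of_nonneg_left (rpow_le_rpow_of_nonpos ht h1 (by linarith)) h2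
  · exact mul_le_mul_of_nonpos_left (rpow_le_rpow_of_nonpos ht₀ h1 (by linarith)) h2

/-- The integral inequality, for exponents `a ≤ a₀` of the weights. -/
theorem CondD.integral_nonneg {a₀ a q₀ q : ℝ} (hq₀ : 0 < q₀) (hqq : q₀ ≤ q) (ha : a ≤ a₀)
    {f g : ℝ → ℝ} (hf : Measurable f) (hg : Measurable g) (hD : CondD f g)
    (hint₀ : IntegrableOn
      (fun t => (rearr f t ^ q₀ - rearr g t ^ q₀) * t ^ (a₀ - 1)) (Set.Ioi 0))
    (hpos₀ : 0 ≤ ∫ t in Set.Ioi (0:ℝ), (rearr f t ^ q₀ - rearr g t ^ q₀) * t ^ (a₀ - 1))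
    (hint : IntegrableOn
      (fun t => (rearr f t ^ q - rearr g t ^ q) * t ^ (a - 1)) (Set.Ioi 0)) :
    0 ≤ ∫ t in Set.Ioi (0:ℝ), (rearr f t ^ q - rearr g t ^ q) * t ^ (a - 1) := by
  have hq : 0 < q := hq₀.trans_le hqq
  rcases hD.rearr_dichotomy hf hg with h | h | ⟨τ₀, hτ₀, t₀, ht₀, h⟩
  · have hle : ∀ t ∈ Set.Ioi (0:ℝ), (rearr f t ^ q₀ - rearr g t ^ q₀) * t ^ (a₀ - 1) ≤ 0 :=
      fun t ht => mul_nonpos_of_nonpos_of_nonneg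
        (sub_nonpos.mpr (rpow_le_rpow (rearr_nonneg f t) (h t ht) hq₀.le))
        (rpow_nonneg (le_of_lt ht) _)
    have hzero := (setIntegral_eq_zero_iff_of_nonneg_ae
      (f := fun t => -((rearr f t ^ q₀ - rearr g t ^ q₀) * t ^ (a₀ - 1)))
      ((ae_restrict_iff' measurableSet_Ioi).mpr
        (Eventually.of_forall fun t ht => neg_nonneg.mpr (hle t ht))) hint₀.neg).mp (by
          rw [integral_neg, neg_eq_zero]
          exact le_antisymm (setIntegral_nonpos measurableSet_Ioi hle) hpos₀)
    refine (integral_eq_zero_of_ae ?_).ge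
    filter_upwards [hzero, ae_restrict_mem measurableSet_Ioi] with t h0 ht
    have h1 : rearr f t ^ q₀ = rearr g t ^ q₀ := by
      have h2 := (mul_eq_zero.mp (neg_eq_zero.mp h0)).resolve_right (rpow_pos_of_pos ht _).ne'
      linarith
    have h2 : rearr f t = rearr g t :=
      (rpow_left_inj (rearr_nonneg f t) (rearr_nonneg g t) hq₀.ne').mp h1
    simp [h2]
  · exact setIntegral_nonneg measurableSet_Ioi fun t ht => mul_nonneg
      (sub_nonneg.mpr (rpow_le_rpow (rearr_nonneg g t) (h t ht) hq.le))
      (rpow_nonneg (le_of_lt ht) _)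
  · set c := q / q₀ * (τ₀ ^ q₀) ^ (q / q₀ - 1)
    have hc0 : 0 ≤ c := by positivity
    have hb0 : 0 ≤ t₀ ^ (a - a₀) := rpow_nonneg ht₀.le _
    refine le_trans (mul_nonneg (mul_nonneg hc0 hb0) hpos₀) ?_
    rw [← integral_const_mul]
    refine setIntegral_mono_on (hint₀.const_mul _) hint measurableSet_Ioi fun t ht => ?_
    have hf0 := rearr_nonneg f t
    have hg0 := rearr_nonneg g t
    have hpow := rpow_sub_rpow_compare hf0 hg0 hτ₀ hq₀ hqq ((h t ht).imp And.right And.right)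
    have hwt := mul_rpow_compare (d := rearr f t ^ q₀ - rearr g t ^ q₀) ht ht₀ ha
      ((h t ht).imp
        (fun h => ⟨h.1, sub_nonneg.mpr (rpow_le_rpow hg0 h.2.2 hq₀.le)⟩)
        (fun h => ⟨h.1, sub_nonpos.mpr (rpow_le_rpow hf0 h.2.1 hq₀.le)⟩))
    calc _ = c * (t₀ ^ (a - a₀) * ((rearr f t ^ q₀ - rearr g t ^ q₀) * t ^ (a₀ - 1))) :=
          mul_assoc _ _ _
      _ ≤ c * ((rearr f t ^ q₀ - rearr g t ^ q₀) * t ^ (a - 1)) :=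
          mul_le_mul_of_nonneg_left hwt hc0
      _ = c * (rearr f t ^ q₀ - rearr g t ^ q₀) * t ^ (a - 1) := (mul_assoc _ _ _).symm
      _ ≤ _ := mul_le_mul_of_nonneg_right hpow (rpow_nonneg (le_of_lt ht) _)

/-- Nazarov–Podkorytov type result for Lorentz `L(p,q)` spaces: sufficiency of the
conditions `p₀ ≤ p`, `q₀ ≤ q`, `q/p ≤ q₀/p₀`. -/
theorem statement4 (p₀ p q₀ q : ℝ) (hp₀ : 0 < p₀) (hq₀ : 0 < q₀)
    (hpp : p₀ ≤ p) (hqq : q₀ ≤ q) (hratio : q / p ≤ q₀ / p₀)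
    (f g : ℝ → ℝ) (hf : Measurable f) (hg : Measurable g)
    (hD : CondD f g)
    (hint₀ : IntegrableOn
      (fun t => (rearr f t ^ q₀ - rearr g t ^ q₀) * t ^ (q₀ / p₀ - 1)) (Set.Ioi 0))
    (hpos₀ : 0 ≤ (q₀ / p₀) *
      ∫ t in Set.Ioi (0:ℝ), (rearr f t ^ q₀ - rearr g t ^ q₀) * t ^ (q₀ / p₀ - 1))
    (hint : IntegrableOn
      (fun t => (rearr f t ^ q - rearr g t ^ q) * t ^ (q / p - 1)) (Set.Ioi 0)) :
    0 ≤ (q / p) * ∫ t in Set.Ioi (0:ℝ), (rearr f t ^ q - rearr g t ^ q) * t ^ (q / p - 1) ∧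
    (IntegrableOn (fun s => rearr f s ^ q * s ^ (q / p - 1)) (Set.Ioi 0) →
     IntegrableOn (fun s => rearr g s ^ q * s ^ (q / p - 1)) (Set.Ioi 0) →
     ((q / p) * ∫ s in Set.Ioi (0:ℝ), rearr g s ^ q * s ^ (q / p - 1)) ^ (1 / q) ≤
       ((q / p) * ∫ s in Set.Ioi (0:ℝ), rearr f s ^ q * s ^ (q / p - 1)) ^ (1 / q)) := by
  have hp : 0 < p := hp₀.trans_le hpp
  have hq : 0 < q := hq₀.trans_le hqq
  have hmain := hD.integral_nonneg hq₀ hqq hratio hf hg hint₀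
    (nonneg_of_mul_nonneg_right hpos₀ (div_pos hq₀ hp₀)) hint
  refine ⟨mul_nonneg (div_pos hq hp).le hmain, fun hfi hgi => ?_⟩
  have hle : ∫ s in Set.Ioi (0:ℝ), rearr g s ^ q * s ^ (q / p - 1) ≤
      ∫ s in Set.Ioi (0:ℝ), rearr f s ^ q * s ^ (q / p - 1) := by
    rw [← sub_nonneg, ← integral_sub hfi hgi]
    simpa only [sub_mul] using hmain
  have hg0 : 0 ≤ ∫ s in Set.Ioi (0:ℝ), rearr g s ^ q * s ^ (q / p - 1) :=
    setIntegral_nonneg measurableSet_Ioi fun t ht =>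
      mul_nonneg (rpow_nonneg (rearr_nonneg g t) _) (rpow_nonneg (le_of_lt ht) _)
  have hqp : 0 ≤ q / p := (div_pos hq hp).le
  exact rpow_le_rpow (mul_nonneg hqp hg0) (mul_le_mul_of_nonneg_left hle hqp)
    (one_div_pos.mpr hq).le
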